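/- Let (X, μ, G) be an mcp acyclic locally countable Borel graph with Radon–Nikodym cocycle 𝔴 (of E_G), and suppose there is a subrelation F ⊆ E_G which is a properly ergodic mcp CBER of type III such that for almost every x ∈ X and every directed edge (x,y) ∈ G, the half-space N_{(x,y)} contains an entire F-class. Then for almost every component of G, no end of that component is vanishing. -/

import Mathlib

open MeasureTheory Set Filter
open scoped ENNReal ENat Topology

noncomputable section

variable {X : Type*}

/-- The integral of `f` over the set of edges `A` against the "left" measure `ν_l`
determined by `μ`:  `∫ₐ f dν_l = ∫ₓ Σ_{y : (x,y) ∈ A} f(x,y) dμ(x)`. -/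
def lintL [MeasurableSpace X] (μ : Measure X) (f : X × X → ℝ≥0∞) (A : Set (X × X)) : ℝ≥0∞ :=
  ∫⁻ x, ∑' y : {y : X // (x, y) ∈ A}, f (x, (y : X)) ∂μ

/-- The integral of `f` over the set of edges `A` against the "right" measure `ν_r`
determined by `μ`:  `∫ₐ f dν_r = ∫ₓ Σ_{y : (y,x) ∈ A} f(y,x) dμ(x)`. -/
def lintR [MeasurableSpace X] (μ : Measure X) (f : X × X → ℝ≥0∞) (A : Set (X × X)) : ℝ≥0∞ :=
  ∫⁻ x, ∑' y : {y : X // (y, x) ∈ A}, f ((y : X), x) ∂μ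

/-- `ν_l(A) = ∫ₓ |{y : (x,y) ∈ A}| dμ(x)`. -/
def nuL [MeasurableSpace X] (μ : Measure X) (A : Set (X × X)) : ℝ≥0∞ :=
  lintL μ (fun _ => 1) A

/-- `ν_r(A) = ∫ₓ |{y : (y,x) ∈ A}| dμ(x)`. -/
def nuR [MeasurableSpace X] (μ : Measure X) (A : Set (X × X)) : ℝ≥0∞ :=
  lintR μ (fun _ => 1) A

/-- `E` is measure-class-preserving w.r.t. `μ`: `ν_l` and `ν_r` are mutually absolutely
continuous on Borel subsets of `E`. -/
def MCP [MeasurableSpace X] (μ : Measure X) (E : Set (X × X)) : Prop :=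
  ∀ A : Set (X × X), A ⊆ E → MeasurableSet A → (nuL μ A = 0 ↔ nuR μ A = 0)

/-- `E` is measure-preserving w.r.t. `μ`: `ν_l = ν_r` on Borel subsets of `E`. -/
def MPrel [MeasurableSpace X] (μ : Measure X) (E : Set (X × X)) : Prop :=
  ∀ A : Set (X × X), A ⊆ E → MeasurableSet A → nuL μ A = nuR μ A

/-- A countable Borel equivalence relation: a Borel equivalence relation all of whose
classes are countable. -/
def IsCBER [MeasurableSpace X] (E : Set (X × X)) : Prop :=
  MeasurableSet E ∧ Equivalence (fun x y => (x, y) ∈ E) ∧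
    ∀ x : X, {y | (x, y) ∈ E}.Countable

/-- The `E`-saturation of a set `A`. -/
def ESat (E : Set (X × X)) (A : Set X) : Set X :=
  {x | ∃ y ∈ A, (x, y) ∈ E}

/-- `E` is ergodic w.r.t. `μ`: every non-null Borel set is a complete section. -/
def ErgodicRel [MeasurableSpace X] (μ : Measure X) (E : Set (X × X)) : Prop :=
  ∀ A : Set X, MeasurableSet A → μ A ≠ 0 → μ (ESat E A)ᶜ = 0

/-- `E` is properly ergodic: ergodic, and `μ` is not concentrated on a single `E`-class. -/
def ProperlyErgodicRel [MeasurableSpace X] (μ : Measure X) (E : Set (X × X)) : Prop :=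
  ErgodicRel μ E ∧ ∀ x : X, μ {y | (x, y) ∉ E} ≠ 0

/-- `μ'` is `E`-invariant: every Borel bijection between Borel subsets whose graph is
contained in `E` pushes the restricted measure forward to the restricted measure. -/
def InvariantUnder [MeasurableSpace X] (μ' : Measure X) (E : Set (X × X)) : Prop :=
  ∀ (f : X → X) (A : Set X), Measurable f → MeasurableSet A → Set.InjOn f A →
    (∀ x ∈ A, (x, f x) ∈ E) →
    Measure.map f (μ'.restrict A) = μ'.restrict (f '' A)

/-- Mutual absolute continuity of measures. -/
def EquivMeasure [MeasurableSpace X] (μ' μ : Measure X) : Prop :=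
  μ' ≪ μ ∧ μ ≪ μ'

/-- Type II: `μ` is non-atomic and some σ-finite measure equivalent to `μ` is `E`-invariant. -/
def IsTypeII [MeasurableSpace X] (μ : Measure X) (E : Set (X × X)) : Prop :=
  NoAtoms μ ∧
    ∃ μ' : Measure X, SigmaFinite μ' ∧ EquivMeasure μ' μ ∧ InvariantUnder μ' E

/-- Type III: no σ-finite measure equivalent to `μ` is `E`-invariant. -/
def IsTypeIII [MeasurableSpace X] (μ : Measure X) (E : Set (X × X)) : Prop :=
  ¬ ∃ μ' : Measure X, SigmaFinite μ' ∧ EquivMeasure μ' μ ∧ InvariantUnder μ' E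

/-- `w` is (a pointwise-cocycle version of) the Radon–Nikodym cocycle `𝔴 = dν_l/dν_r` of the
mcp relation `E`: it is Borel, takes values in `(0,∞)` on `E`, satisfies the cocycle identity,
and `ν_l(A) = ∫_A w dν_r` for every Borel `A ⊆ E`. -/
def IsRNCocycle [MeasurableSpace X] (μ : Measure X) (E : Set (X × X))
    (w : X × X → ℝ≥0∞) : Prop :=
  Measurable w ∧
  (∀ e ∈ E, w e ≠ 0 ∧ w e ≠ ∞) ∧
  (∀ x y z : X, (y, x) ∈ E → (z, y) ∈ E → w (z, y) * w (y, x) = w (z, x)) ∧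
  (∀ x : X, w (x, x) = 1) ∧
  ∀ A : Set (X × X), A ⊆ E → MeasurableSet A → nuL μ A = lintR μ w A

/-- The connectedness relation of a graph `G`: `x` and `y` are related iff they are joined
by a path of edges of `G`. -/
def connRel (G : Set (X × X)) : Set (X × X) :=
  {p | Relation.ReflTransGen (fun a b => (a, b) ∈ G) p.1 p.2}

/-- The symmetrization of a directed graph. -/
def symmCl (G : Set (X × X)) : Set (X × X) :=
  {p | p ∈ G ∨ (p.2, p.1) ∈ G}

/-- The graph distance in `G` (with value `⊤` between distinct components). -/
def gdist (G : Set (X × X)) (x y : X) : ℕ∞ :=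
  sInf ((fun m : ℕ => (m : ℕ∞)) ''
    {m : ℕ | ∃ c : ℕ → X, c 0 = x ∧ c m = y ∧ ∀ i < m, (c i, c (i + 1)) ∈ G})

/-- For a directed edge `(x,y)` of an acyclic graph `G`, the half-space
`N_{(x,y)} = {z : d_G(y,z) < d_G(x,z)}`. -/
def halfSpace (G : Set (X × X)) (x y : X) : Set X :=
  {z | gdist G y z < gdist G x z}

/-- A geodesic ray in `G`. -/
def IsGeodesicRay (G : Set (X × X)) (r : ℕ → X) : Prop :=
  (∀ i : ℕ, (r i, r (i + 1)) ∈ G) ∧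
    ∀ i j : ℕ, i ≤ j → gdist G (r i) (r j) = ((j - i : ℕ) : ℕ∞)

/-- The end represented by the geodesic ray `r` is vanishing w.r.t. the cocycle `w`:
`sup {w(y, r 0) : y ∈ N_{(r i, r (i+1))}} → 0` as `i → ∞`. -/
def VanishingEnd (w : X × X → ℝ≥0∞) (G : Set (X × X)) (r : ℕ → X) : Prop :=
  Tendsto (fun i : ℕ => ⨆ y ∈ halfSpace G (r i) (r (i + 1)), w (y, r 0))
    atTop (nhds 0)

/-- A (symmetric) graph is acyclic if it has no injective cycle of length `≥ 3`. -/
def AcyclicGraph (G : Set (X × X)) : Prop :=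
  ∀ (n : ℕ) (c : ℕ → X), 2 < n → (∀ i < n, (c i, c ((i + 1) % n)) ∈ G) →
    ¬ Function.Injective fun i : Fin n => c (i : ℕ)

/-- Amenability of a locally countable Borel graph `G` (w.r.t. the measure `μ`):
there are Borel a.e.-averaging functions `λ_n` on the connectedness relation of `G`. -/
def AmenableGraph [MeasurableSpace X] (μ : Measure X) (G : Set (X × X)) : Prop :=
  ∃ lam : ℕ → X × X → ℝ,
    (∀ n, Measurable (lam n)) ∧
    (∀ n e, 0 ≤ lam n e) ∧
    (∀ᵐ x ∂μ, ∀ n : ℕ, ∑' y : {y : X // (x, y) ∈ connRel G}, lam n (x, (y : X)) = 1) ∧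
    nuL μ {e ∈ G | ¬ Tendsto
        (fun n : ℕ => ∑' z : {z : X // (e.1, z) ∈ connRel G},
          |lam n (e.1, (z : X)) - lam n (e.2, (z : X))|)
        atTop (nhds 0)} = 0

/-- The Schreier graph of an action of a free group, with respect to the free basis. -/
def schreier {ι : Type*} [MeasurableSpace X] (φ : FreeGroup ι →* Equiv.Perm X) :
    Set (X × X) :=
  {p | p.1 ≠ p.2 ∧ ∃ s : ι,
    φ (FreeGroup.of s) p.1 = p.2 ∨ φ (FreeGroup.of s) p.2 = p.1}


/-- Inner approximation of the range of a continuous function on Baire space. -/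
theorem nve_aux_inner [TopologicalSpace X] [PolishSpace X] [MeasurableSpace X] [BorelSpace X]
    (μ : Measure X) [IsFiniteMeasure μ] (f : (ℕ → ℕ) → X) (hf : Continuous f)
    (c : ℝ≥0∞) (hc : c < μ (range f)) :
    ∃ K : Set X, MeasurableSet K ∧ K ⊆ range f ∧ c ≤ μ K := by
  have step : ∀ (k : ℕ) (U : {U : Set (ℕ → ℕ) // c < μ (f '' U)}),
      ∃ m : ℕ, c < μ (f '' (U.1 ∩ {x | x k ≤ m})) := by
    rintro k ⟨U, hU⟩
    have h1 : f '' U = ⋃ m : ℕ, f '' (U ∩ {x | x k ≤ m}) := by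
      rw [← image_iUnion, ← inter_iUnion]
      congr 1
      ext x
      simp only [mem_inter_iff, mem_iUnion, mem_setOf_eq]
      exact ⟨fun h => ⟨h, x k, le_rfl⟩, fun h => h.1⟩
    have hmono : Monotone fun m : ℕ => f '' (U ∩ {x | x k ≤ m}) := by
      intro a b hab
      exact image_mono (inter_subset_inter_right _ fun x (hx : x k ≤ a) => le_trans hx hab)
    rw [h1, hmono.measure_iUnion] at hU
    exact lt_iSup_iff.1 hU
  choose m hm using step
  let V : ℕ → {U : Set (ℕ → ℕ) // c < μ (f '' U)} := fun k =>
    Nat.rec ⟨univ, by rwa [image_univ]⟩ (fun k U => ⟨U.1 ∩ {x | x k ≤ m k U}, hm k U⟩) k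
  let n : ℕ → ℕ := fun k => m k (V k)
  have hVs : ∀ k, (V (k+1)).1 = (V k).1 ∩ {x | x k ≤ n k} := fun k => rfl
  have hV : ∀ k, ∀ x ∈ (V k).1, ∀ i < k, x i ≤ n i := by
    intro k
    induction k with
    | zero => intro x _ i hi; omega
    | succ k ih =>
      intro x hx i hi
      rw [hVs] at hx
      rcases Nat.lt_succ_iff_lt_or_eq.1 hi with h | h
      · exact ih x hx.1 i h
      · subst h; exact hx.2
  let K : Set (ℕ → ℕ) := Set.pi univ fun i => Iic (n i)
  have hK : IsCompact K := isCompact_univ_pi fun i => (finite_Iic (n i)).isCompact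
  refine ⟨f '' K, (hK.image hf).measurableSet, image_subset_range _ _, ?_⟩
  by_contra hlt
  push Not at hlt
  obtain ⟨O, hO, hOo, hOc⟩ := (f '' K).exists_isOpen_lt_of_lt c hlt
  have hex : ∀ k, ∃ x ∈ (V k).1, f x ∉ O := by
    intro k
    by_contra h
    push Not at h
    have : μ (f '' (V k).1) ≤ μ O := measure_mono (by rintro _ ⟨x, hx, rfl⟩; exact h x hx)
    exact absurd ((V k).2.trans_le this) (not_lt.2 hOc.le)
  choose x hxV hxO using hex
  let y : ℕ → ℕ → ℕ := fun k i => min (x k i) (n i)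
  have hy : ∀ k, y k ∈ K := fun k i _ => mem_Iic.2 (min_le_right (x k i) (n i))
  obtain ⟨a, haK, φ, hφ, hlim⟩ := hK.tendsto_subseq hy
  have hlim' : Tendsto (fun j => x (φ j)) atTop (𝓝 a) := by
    rw [tendsto_pi_nhds] at hlim ⊢
    intro i
    refine (hlim i).congr' ?_
    filter_upwards [eventually_gt_atTop i] with j hj
    have : i < φ j := lt_of_lt_of_le hj (hφ.id_le j)
    simp only [Function.comp, y]
    exact min_eq_left (hV _ _ (hxV _) i this)
  have := (hf.tendsto a).comp hlim'
  have h2 := this.eventually (hOo.mem_nhds (hO ⟨a, haK, rfl⟩))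
  obtain ⟨j, hj⟩ := h2.exists
  exact hxO _ hj

theorem nve_aux_analytic_fin [TopologicalSpace X] [PolishSpace X] [MeasurableSpace X]
    [BorelSpace X] (μ : Measure X) [IsFiniteMeasure μ] (S : Set X) (hS : AnalyticSet S) :
    NullMeasurableSet S μ := by
  rw [AnalyticSet] at hS
  rcases hS with rfl | ⟨f, hf, rfl⟩
  · exact MeasurableSet.empty.nullMeasurableSet
  by_cases h0 : μ (range f) = 0
  · exact NullMeasurableSet.of_null h0
  obtain ⟨u, -, hu, hulim⟩ := exists_seq_strictMono_tendsto' (pos_iff_ne_zero.2 h0)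
  choose K hKm hKs hKc using fun n => nve_aux_inner μ f hf (u n) (hu n).2
  have hle : μ (range f) ≤ μ (⋃ n, K n) :=
    le_of_tendsto' hulim fun n => (hKc n).trans (measure_mono (subset_iUnion K n))
  have hsub : (⋃ n, K n) ⊆ range f := iUnion_subset hKs
  have hKM : MeasurableSet (⋃ n, K n) := MeasurableSet.iUnion hKm
  have := ae_eq_of_subset_of_measure_ge (hsub.trans (subset_toMeasurable μ (range f)))
    (by rwa [measure_toMeasurable]) hKM.nullMeasurableSet (measure_ne_top _ _)
  refine ⟨_, hKM, ?_⟩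
  refine Filter.EventuallyLE.antisymm ?_ (hsub.eventuallyLE)
  exact (subset_toMeasurable μ (range f)).eventuallyLE.trans this.symm.le

theorem nve_aux_proj [MeasurableSpace X] [StandardBorelSpace X] (μ : Measure X) [SigmaFinite μ]
    (A : Set (X × X)) (hA : MeasurableSet A) :
    NullMeasurableSet {x | ∃ y, (y, x) ∈ A} μ := by
  obtain ⟨ν, hν, hac, -⟩ := exists_isFiniteMeasure_absolutelyContinuous μ
  letI := upgradeStandardBorel X
  have h : {x | ∃ y, (y, x) ∈ A} = Prod.snd '' A := by
    ext x; simp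
  rw [h]
  exact (nve_aux_analytic_fin ν _ (hA.analyticSet_image measurable_snd)).mono_ac hac

theorem nve_aux_sat [MeasurableSpace X] [StandardBorelSpace X] (μ : Measure X) [SigmaFinite μ]
    (E : Set (X × X)) (hE : MeasurableSet E) (hm : MCP μ E) (p : X → Prop)
    (hp : ∀ᵐ x ∂μ, p x) : ∀ᵐ x ∂μ, ∀ y, (y, x) ∈ E → p y := by
  obtain ⟨N, hpN, hN, hN0⟩ := exists_measurable_superset_of_null (ae_iff.1 hp)
  set A : Set (X × X) := E ∩ Prod.fst ⁻¹' N with hAdef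
  have hA : MeasurableSet A := hE.inter (measurable_fst hN)
  have hL : nuL μ A = 0 := by
    unfold nuL lintL
    rw [← lintegral_zero (μ := μ)]
    refine lintegral_congr_ae ?_
    have : ∀ᵐ x ∂μ, x ∉ N := by rw [ae_iff]; simpa using hN0
    filter_upwards [this] with x hx
    have : IsEmpty {y : X // (x, y) ∈ A} := ⟨fun y => hx y.2.2⟩
    simp
  have hR := (hm A inter_subset_left hA).1 hL
  have hS := nve_aux_proj μ A hA
  obtain ⟨T, hTS, hT, hTe⟩ := hS.exists_measurable_subset_ae_eq
  have hT0 : μ T = 0 := by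
    rw [← nonpos_iff_eq_zero, ← hR, ← lintegral_indicator_one hT]
    refine lintegral_mono fun x => ?_
    by_cases hx : x ∈ T
    · obtain ⟨y, hy⟩ := hTS hx
      simp only [hx, indicator_of_mem, Pi.one_apply]
      exact ENNReal.le_tsum (f := fun _ : {y : X // (y, x) ∈ A} => (1:ℝ≥0∞)) ⟨y, hy⟩
    · simp [hx]
  have hS0 : μ {x | ∃ y, (y, x) ∈ A} = 0 := by rw [← measure_congr hTe, hT0]
  rw [ae_iff]
  refine measure_mono_null ?_ hS0
  intro x hx
  simp only [mem_setOf_eq, not_forall] at hx ⊢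
  obtain ⟨y, hy, hpy⟩ := hx
  exact ⟨y, hy, hpN hpy⟩

theorem nve_aux_image [MeasurableSpace X] [StandardBorelSpace X] (μ : Measure X)
    (E : Set (X × X)) (hE : Equivalence (fun x y => (x, y) ∈ E))
    (w : X × X → ℝ≥0∞) (hw : IsRNCocycle μ E w)
    (f : X → X) (B : Set X) (hf : Measurable f) (hB : MeasurableSet B) (hinj : InjOn f B)
    (hg : ∀ x ∈ B, (x, f x) ∈ E) :
    μ (f '' B) = ∫⁻ x in B, w (f x, x) ∂μ := by
  set A : Set (X × X) := {p | p.2 ∈ B ∧ p.1 = f p.2} with hAdef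
  have hA : MeasurableSet A :=
    (measurable_snd hB).inter (measurableSet_eq_fun measurable_fst (hf.comp measurable_snd))
  have hAE : A ⊆ E := by
    rintro ⟨a, b⟩ ⟨hb, hab⟩
    simp only at hb hab
    subst hab
    exact hE.symm (hg b hb)
  have key := hw.2.2.2.2 A hAE hA
  have hfB : MeasurableSet (f '' B) := hB.image_of_measurable_injOn hf hinj
  rw [← lintegral_indicator_one hfB, ← lintegral_indicator hB]
  convert key using 1
  · unfold nuL lintL
    refine lintegral_congr fun x => ?_
    by_cases hx : x ∈ f '' B
    · obtain ⟨b, hb, rfl⟩ := hx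
      have : Unique {y : X // (f b, y) ∈ A} :=
        { default := ⟨b, hb, rfl⟩
          uniq := fun y => Subtype.ext (hinj y.2.1 hb y.2.2.symm) }
      rw [indicator_of_mem (mem_image_of_mem f hb), tsum_fintype]
      simp
    · have : IsEmpty {y : X // (x, y) ∈ A} := ⟨fun y => hx ⟨y, y.2.1, y.2.2.symm⟩⟩
      simp [hx]
  · unfold lintR
    refine lintegral_congr fun x => ?_
    by_cases hx : x ∈ B
    · rw [indicator_of_mem hx,
        tsum_eq_single (⟨f x, hx, rfl⟩ : {y : X // (y, x) ∈ A})
          (fun b hb => absurd (Subtype.ext b.2.2) hb)]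
    · have : IsEmpty {y : X // (y, x) ∈ A} := ⟨fun y => hx y.2.1⟩
      simp [hx]

/-- The supremum of the cocycle over the `F`-class. -/
def nveSup (w : X × X → ℝ≥0∞) (F : Set (X × X)) (x : X) : ℝ≥0∞ :=
  ⨆ y, ⨆ (_ : (x, y) ∈ F), w (y, x)

theorem nveSup_mul {w : X × X → ℝ≥0∞} {E F : Set (X × X)} (hFE : F ⊆ E)
    (hE : Equivalence (fun x y => (x, y) ∈ E))
    (hF : Equivalence (fun x y => (x, y) ∈ F))
    (hco : ∀ x y z : X, (y, x) ∈ E → (z, y) ∈ E → w (z, y) * w (y, x) = w (z, x))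
    {x y : X} (hxy : (x, y) ∈ F) : nveSup w F x = w (y, x) * nveSup w F y := by
  unfold nveSup
  simp only [ENNReal.mul_iSup]
  refine iSup_congr fun z => ?_
  refine iSup_congr_Prop ⟨fun h => hF.trans (hF.symm hxy) h, fun h => hF.trans hxy h⟩ fun h => ?_
  rw [mul_comm]
  exact (hco x y z (hE.symm (hFE hxy)) (hE.symm (hFE h))).symm

theorem nveSup_aemeasurable [MeasurableSpace X] [StandardBorelSpace X] (μ : Measure X)
    [SigmaFinite μ] (w : X × X → ℝ≥0∞) (F : Set (X × X)) (hw : Measurable w)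
    (hF : MeasurableSet F) : AEMeasurable (nveSup w F) μ := by
  have : NullMeasurable (nveSup w F) μ := by
    refine @measurable_of_Ioi ℝ≥0∞ (NullMeasurableSpace X μ) _ _ _ _ _ _ _ _ fun a => ?_
    have h := nve_aux_proj μ {p : X × X | (p.2, p.1) ∈ F ∧ a < w p}
      ((measurable_swap hF).inter (measurableSet_lt measurable_const hw))
    have he : nveSup w F ⁻¹' Ioi a =
        {x | ∃ y, (y, x) ∈ {p : X × X | (p.2, p.1) ∈ F ∧ a < w p}} := by
      ext x
      simp [nveSup, lt_iSup_iff]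
    rw [← he] at h
    exact h
  exact this.aemeasurable

theorem nve_aux_top [MeasurableSpace X] [StandardBorelSpace X] (μ : Measure X) [SigmaFinite μ]
    (E : Set (X × X)) (hE : Equivalence (fun x y => (x, y) ∈ E))
    (w : X × X → ℝ≥0∞) (hw : IsRNCocycle μ E w)
    (F : Set (X × X)) (hFE : F ⊆ E) (hF : IsCBER F)
    (herg : ErgodicRel μ F) (hIII : IsTypeIII μ F) :
    ∀ᵐ x ∂μ, nveSup w F x = ∞ := by
  have hs : AEMeasurable (nveSup w F) μ := nveSup_aemeasurable μ w F hw.1 hF.1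
  have hmul : ∀ {x y : X}, (x, y) ∈ F → nveSup w F x = w (y, x) * nveSup w F y :=
    fun h => nveSup_mul hFE hE hF.2.1 hw.2.2.1 h
  by_contra hcon
  rw [ae_iff] at hcon
  have hfin : ∀ᵐ x ∂μ, nveSup w F x ≠ ∞ := by
    have hB : NullMeasurableSet {x | ¬ nveSup w F x = ∞} μ :=
      hs.nullMeasurable (measurableSet_singleton ∞).compl
    obtain ⟨B, hBs, hBm, hBe⟩ := hB.exists_measurable_subset_ae_eq
    rw [← measure_congr hBe] at hcon
    have h := herg B hBm hcon
    rw [ae_iff]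
    refine measure_mono_null ?_ h
    intro x hx hx'
    obtain ⟨y, hy, hxy⟩ := hx'
    apply hx
    rw [hmul hxy]
    exact ENNReal.mul_ne_top (hw.2.1 _ (hE.symm (hFE hxy))).2 (hBs hy)
  have hpos : ∀ x, nveSup w F x ≠ 0 := by
    intro x h0
    have : w (x, x) ≤ nveSup w F x := le_iSup₂_of_le x (hF.2.1.refl x) le_rfl
    rw [hw.2.2.2.1, h0] at this
    simp at this
  apply hIII
  refine ⟨μ.withDensity (nveSup w F), ?_, ⟨withDensity_absolutelyContinuous _ _,
    withDensity_absolutelyContinuous' hs (ae_of_all _ hpos)⟩, ?_⟩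
  · rw [withDensity_congr_ae hs.ae_eq_mk]
    refine SigmaFinite.withDensity_of_ne_top ?_
    filter_upwards [hfin, hs.ae_eq_mk] with x h1 h2
    rwa [← h2]
  intro f A hf hA hinj hg
  ext C hC
  rw [Measure.map_apply hf hC, Measure.restrict_apply (hf hC), Measure.restrict_apply hC]
  have hB : MeasurableSet (f ⁻¹' C ∩ A) := (hf hC).inter hA
  have hCB : C ∩ f '' A = f '' (f ⁻¹' C ∩ A) := by
    rw [inter_comm, ← image_inter_preimage, inter_comm]
  rw [hCB]
  have hBA : f ⁻¹' C ∩ A ⊆ A := inter_subset_right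
  generalize f ⁻¹' C ∩ A = B at hB hBA
  have hinjB := hinj.mono hBA
  have hgB : ∀ x ∈ B, (x, f x) ∈ F := fun x hx => hg x (hBA hx)
  have hfB : MeasurableSet (f '' B) := hB.image_of_measurable_injOn hf hinjB
  rw [withDensity_apply _ hB, withDensity_apply _ hfB]
  have hwm : Measurable fun x => w (f x, x) := hw.1.comp (hf.prodMk measurable_id)
  have hmap : μ.restrict (f '' B) =
      Measure.map f ((μ.restrict B).withDensity fun x => w (f x, x)) := by
    ext D hD
    rw [Measure.restrict_apply hD, Measure.map_apply hf hD, withDensity_apply _ (hf hD),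
      Measure.restrict_restrict (hf hD)]
    have : D ∩ f '' B = f '' (f ⁻¹' D ∩ B) := by
      rw [inter_comm, ← image_inter_preimage, inter_comm]
    rw [this]
    exact nve_aux_image μ E hE w hw f _ hf ((hf hD).inter hB) (hinjB.mono inter_subset_right)
      fun x hx => hFE (hgB x hx.2)
  have hs' : AEMeasurable (nveSup w F) (μ.restrict (f '' B)) := hs.restrict
  rw [hmap] at hs' ⊢
  rw [lintegral_map' hs' hf.aemeasurable,
    lintegral_withDensity_eq_lintegral_mul_non_measurable _ hwm]
  · refine setLIntegral_congr_fun hB fun x hx => ?_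
    simp only [Pi.mul_apply]
    exact hmul (hgB x hx)
  · rw [ae_restrict_iff' hB]
    exact ae_of_all _ fun x hx => (hw.2.1 _ (hE.symm (hFE (hgB x hx)))).2.lt_top

theorem nve_aux_conn (G : Set (X × X)) (x y : X) (h : gdist G x y ≠ ⊤) : (x, y) ∈ connRel G := by
  by_contra hn
  apply h
  unfold gdist
  rw [sInf_eq_top]
  rintro _ ⟨m, ⟨c, h0, hm, hc⟩, rfl⟩
  exfalso
  apply hn
  have : ∀ k ≤ m, (c 0, c k) ∈ connRel G := by
    intro k
    induction k with
    | zero => intro _; exact Relation.ReflTransGen.refl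
    | succ k ih => intro hk; exact Relation.ReflTransGen.tail (ih (by omega)) (hc k (by omega))
  have := this m le_rfl
  rwa [h0, hm] at this

/-- Let `G` be an mcp acyclic locally countable Borel graph with
Radon–Nikodym cocycle `𝔴` of `E_G`, and suppose `F ⊆ E_G` is a properly ergodic mcp type III
subrelation such that for a.e. `x` and every edge `(x,y) ∈ G` the half-space `N_{(x,y)}`
contains an entire `F`-class. Then for a.e. component of `G`, no end is vanishing. -/
theorem no_vanishing_ends {X : Type*} [MeasurableSpace X] [StandardBorelSpace X]
    (μ : Measure X) [SigmaFinite μ]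
    (G : Set (X × X)) (hGmeas : MeasurableSet G)
    (hGirr : ∀ x : X, (x, x) ∉ G)
    (hGsymm : ∀ x y : X, (x, y) ∈ G → (y, x) ∈ G)
    (hGlc : ∀ x : X, {y | (x, y) ∈ G}.Countable)
    (hGacyc : AcyclicGraph G)
    (hEG : IsCBER (connRel G)) (hmcp : MCP μ (connRel G))
    (w : X × X → ℝ≥0∞) (hw : IsRNCocycle μ (connRel G) w)
    (F : Set (X × X)) (hFE : F ⊆ connRel G) (hF : IsCBER F)
    (hmcpF : MCP μ F) (hpeF : ProperlyErgodicRel μ F) (hIIIF : IsTypeIII μ F)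
    (hhalf : ∀ᵐ x ∂μ, ∀ y : X, (x, y) ∈ G →
      ∃ z : X, {z' | (z, z') ∈ F} ⊆ halfSpace G x y) :
    ∀ᵐ x ∂μ, ∀ r : ℕ → X, IsGeodesicRay G r → (x, r 0) ∈ connRel G →
      ¬ VanishingEnd w G r := by
  have hE := hEG.2.1
  have htop := nve_aux_top μ (connRel G) hE w hw F hFE hF hpeF.1 hIIIF
  have hgood := nve_aux_sat μ (connRel G) hEG.1 hmcp _ (htop.and hhalf)
  filter_upwards [hgood] with x hx r hr hxr hvan
  have hconn : ∀ i, (r 0, r i) ∈ connRel G := by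
    intro i
    induction i with
    | zero => exact Relation.ReflTransGen.refl
    | succ k ih => exact Relation.ReflTransGen.tail ih (hr.1 k)
  obtain ⟨i, hi⟩ := (hvan.eventually (gt_mem_nhds one_pos)).exists
  obtain ⟨z, hz⟩ := (hx (r i) (hE.symm (hE.trans hxr (hconn i)))).2 (r (i + 1)) (hr.1 i)
  have hzN := hz (hF.2.1.refl z)
  have hrz : (r 0, z) ∈ connRel G :=
    hE.trans (hconn (i + 1)) (nve_aux_conn G _ _ (ne_top_of_lt hzN))
  have hzt := (hx z (hE.symm (hE.trans hxr hrz))).1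
  have hle : nveSup w F z ≤ w (r 0, z) := by
    refine iSup₂_le fun y hy => ?_
    rw [← hw.2.2.1 z (r 0) y hrz (hE.symm (hE.trans hrz (hFE hy)))]
    refine mul_le_of_le_one_left' ?_
    exact (le_iSup₂_of_le (f := fun y _ => w (y, r 0)) y (hz hy) le_rfl).trans hi.le
  rw [hzt, top_le_iff] at hle
  exact (hw.2.1 _ hrz).2 hle
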